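/- Let 0 < ρ < R. Then M_{2,0} < 0, where M_{2,0} = (i0(R)k0(ρ) − i0(ρ)k0(R))·[(i0(R)k1(ρ) + i1(ρ)k0(R)) − (3R²/(R³ − ρ³))(i1(R)k1(ρ) − i1(ρ)k1(R))] − (i1(R)k1(ρ) − i1(ρ)k1(R))·[(i0(ρ)k1(R) + i1(R)k0(ρ)) − (3ρ²/(R³ − ρ³))(i1(R)k1(ρ) − i1(ρ)k1(R))]. -/

import Mathlib

/-- Modified spherical Bessel function `i₀(s) = sinh s / s`. -/
noncomputable def i0 (s : ℝ) : ℝ := Real.sinh s / s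

/-- Modified spherical Bessel function `i₁(s) = cosh s / s - sinh s / s²`. -/
noncomputable def i1 (s : ℝ) : ℝ := Real.cosh s / s - Real.sinh s / s ^ 2

/-- Modified spherical Bessel function `k₀(s) = (π/2) e^{-s} / s`. -/
noncomputable def k0 (s : ℝ) : ℝ := (Real.pi / 2) * Real.exp (-s) / s

/-- Modified spherical Bessel function `k₁(s) = (π/2) e^{-s} (1/s + 1/s²)`. -/
noncomputable def k1 (s : ℝ) : ℝ := (Real.pi / 2) * Real.exp (-s) * (1 / s + 1 / s ^ 2)

open Real in
lemma aux_pos (f f' : ℝ → ℝ) (h : ∀ x, HasDerivAt f (f' x) x) (h0 : f 0 = 0)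
    (hp : ∀ x, 0 < x → 0 < f' x) (x : ℝ) (hx : 0 < x) : 0 < f x := by
  have hm : StrictMonoOn f (Set.Ici 0) := by
    apply strictMonoOn_of_deriv_pos (convex_Ici 0)
    · exact fun y _ => (h y).continuousAt.continuousWithinAt
    · intro y hy
      rw [interior_Ici] at hy
      rw [(h y).deriv]
      exact hp y hy
  have := hm (Set.mem_Ici.2 le_rfl) (Set.mem_Ici.2 hx.le) hx
  rwa [h0] at this

lemma aux1 (x : ℝ) (hx : 0 < x) : 0 < x * Real.cosh x - Real.sinh x := by
  refine aux_pos (fun x => x * Real.cosh x - Real.sinh x) (fun x => x * Real.sinh x) ?_ (by simp)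
    (fun y hy => mul_pos hy (Real.sinh_pos_iff.2 hy)) x hx
  intro y
  have := ((hasDerivAt_id y).mul (Real.hasDerivAt_cosh y)).sub (Real.hasDerivAt_sinh y)
  refine this.congr_deriv ?_
  simp only [id]; ring

lemma aux2a (x : ℝ) (hx : 0 < x) : 0 < 2 + x * Real.sinh x - 2 * Real.cosh x := by
  refine aux_pos (fun x => 2 + x * Real.sinh x - 2 * Real.cosh x)
    (fun x => x * Real.cosh x - Real.sinh x) ?_ (by simp) aux1 x hx
  intro y
  have := (((hasDerivAt_id y).mul (Real.hasDerivAt_sinh y)).const_add 2).sub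
    ((Real.hasDerivAt_cosh y).const_mul 2)
  refine this.congr_deriv ?_
  simp only [id]; ring

lemma aux2 (x : ℝ) (hx : 0 < x) : 0 < 2 * x + x * Real.cosh x - 3 * Real.sinh x := by
  refine aux_pos (fun x => 2 * x + x * Real.cosh x - 3 * Real.sinh x)
    (fun x => 2 + x * Real.sinh x - 2 * Real.cosh x) ?_ (by simp) aux2a x hx
  intro y
  have := (((hasDerivAt_id y).const_mul 2).add
    ((hasDerivAt_id y).mul (Real.hasDerivAt_cosh y))).sub ((Real.hasDerivAt_sinh y).const_mul 3)
  refine this.congr_deriv ?_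
  simp only [id]; ring

lemma aux3 (x : ℝ) (hx : 0 < x) : 0 < x * Real.sinh x + x * x + 4 - 4 * Real.cosh x := by
  refine aux_pos (fun x => x * Real.sinh x + x * x + 4 - 4 * Real.cosh x)
    (fun x => 2 * x + x * Real.cosh x - 3 * Real.sinh x) ?_ (by simp) aux2 x hx
  intro y
  have := ((((hasDerivAt_id y).mul (Real.hasDerivAt_sinh y)).add
    ((hasDerivAt_id y).mul (hasDerivAt_id y))).add_const 4).sub
    ((Real.hasDerivAt_cosh y).const_mul 4)
  refine this.congr_deriv ?_
  simp only [id]; ring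

lemma aux4 (x : ℝ) (hx : 0 < x) :
    0 < 3 * Real.sinh x + x * (x * Real.sinh x) - 3 * (x * Real.cosh x) := by
  refine aux_pos (fun x => 3 * Real.sinh x + x * (x * Real.sinh x) - 3 * (x * Real.cosh x))
    (fun x => x * (x * Real.cosh x - Real.sinh x)) ?_ (by simp)
    (fun y hy => mul_pos hy (aux1 y hy)) x hx
  intro y
  have := (((Real.hasDerivAt_sinh y).const_mul 3).add
    ((hasDerivAt_id y).mul ((hasDerivAt_id y).mul (Real.hasDerivAt_sinh y)))).sub
    (((hasDerivAt_id y).mul (Real.hasDerivAt_cosh y)).const_mul 3)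
  refine this.congr_deriv ?_
  simp only [id, Pi.mul_apply]; ring

lemma aux_main (r d S C : ℝ) (hr : 0 < r) (hd : 0 < d) (hS : 0 < S) (hC : 0 < C)
    (hCS : C ^ 2 = 1 + S ^ 2)
    (h1 : 0 < d * C - S) (h2 : 0 < 2 * d * S ^ 2 + 3 * d - 3 * S * C)
    (h3 : 0 < d * S * C + d ^ 2 - 2 * S ^ 2)
    (h4 : 0 < 3 * S + d * (d * S) - 3 * (d * C)) :
    ((r + d) ^ 3 - r ^ 3) * ((r + d) ^ 2 * S * (r * C + S)
        - (((r + d) * r - 1) * S + d * C) * ((r + d) * C - S))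
      - 3 * (((r + d) * r - 1) * S + d * C)
        * ((r + d) ^ 3 * S - r * (((r + d) * r - 1) * S + d * C)) < 0 := by
  have h5 : 0 < d ^ 3 * C - 3 * (d * C - S) := by
    have : 0 < d ^ 2 * (d * C - S) := by positivity
    nlinarith
  have e0 : 0 < d ^ 3 * (d * S * C + d ^ 2 - 2 * S ^ 2) := by positivity
  have e1 : 0 < r * ((d * C - S) * (d ^ 3 * C - 3 * (d * C - S))
      + 3 * d ^ 2 * (d * S * C + d ^ 2 - 2 * S ^ 2)) := by positivity
  have e2 : 0 < r ^ 2 * (2 * d ^ 2 * (2 * d * S ^ 2 + 3 * d - 3 * S * C)) := by positivity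
  have e3 : 0 < r ^ 3 * (3 * (d * C - S) ^ 2) := by positivity
  have key : ((r + d) ^ 3 - r ^ 3) * ((r + d) ^ 2 * S * (r * C + S)
        - (((r + d) * r - 1) * S + d * C) * ((r + d) * C - S))
      - 3 * (((r + d) * r - 1) * S + d * C)
        * ((r + d) ^ 3 * S - r * (((r + d) * r - 1) * S + d * C))
      = -(d ^ 3 * (d * S * C + d ^ 2 - 2 * S ^ 2)
        + r * ((d * C - S) * (d ^ 3 * C - 3 * (d * C - S))
      + 3 * d ^ 2 * (d * S * C + d ^ 2 - 2 * S ^ 2))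
        + r ^ 2 * (2 * d ^ 2 * (2 * d * S ^ 2 + 3 * d - 3 * S * C))
        + r ^ 3 * (3 * (d * C - S) ^ 2)) := by
    grind
  rw [key]; linarith

/-- M_{2,0} < 0. -/
theorem stmt_16 (ρ R : ℝ) (hρ : 0 < ρ) (hR : ρ < R) :
    (i0 R * k0 ρ - i0 ρ * k0 R)
      * ((i0 R * k1 ρ + i1 ρ * k0 R)
        - (3 * R ^ 2 / (R ^ 3 - ρ ^ 3)) * (i1 R * k1 ρ - i1 ρ * k1 R))
    - (i1 R * k1 ρ - i1 ρ * k1 R)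
      * ((i0 ρ * k1 R + i1 R * k0 ρ)
        - (3 * ρ ^ 2 / (R ^ 3 - ρ ^ 3)) * (i1 R * k1 ρ - i1 ρ * k1 R)) < 0 := by
  have hR0 : 0 < R := hρ.trans hR
  obtain ⟨d, rfl⟩ : ∃ d, R = ρ + d := ⟨R - ρ, by ring⟩
  have hd : 0 < d := by linarith
  have hS : 0 < Real.sinh d := Real.sinh_pos_iff.2 hd
  have hC := Real.cosh_pos d
  have hCS : Real.cosh d ^ 2 = 1 + Real.sinh d ^ 2 := by rw [Real.cosh_sq]; ring
  have hD : 0 < (ρ + d) ^ 3 - ρ ^ 3 := by ring_nf; positivity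
  have sd : Real.sinh d = Real.sinh (ρ + d) * Real.cosh ρ - Real.cosh (ρ + d) * Real.sinh ρ := by
    rw [← Real.sinh_sub]; congr 1; ring
  have cd : Real.cosh d = Real.cosh (ρ + d) * Real.cosh ρ - Real.sinh (ρ + d) * Real.sinh ρ := by
    rw [← Real.cosh_sub]; congr 1; ring
  have h2 := aux2 (2 * d) (by positivity)
  have h3 := aux3 (2 * d) (by positivity)
  rw [Real.cosh_two_mul, Real.sinh_two_mul, hCS] at h2 h3
  have hm := aux_main ρ d _ _ hρ hd hS hC hCS (aux1 d hd) (by nlinarith) (by nlinarith) (aux4 d hd)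
  have hA : i0 (ρ + d) * k0 ρ - i0 ρ * k0 (ρ + d)
      = Real.pi / 2 * (Real.sinh d / ((ρ + d) * ρ)) := by
    unfold i0 k0
    rw [sd, ← Real.cosh_sub_sinh ρ, ← Real.cosh_sub_sinh (ρ + d)]
    generalize ρ + d = R at *
    field_simp; ring
  have hB : i0 (ρ + d) * k1 ρ + i1 ρ * k0 (ρ + d)
      = Real.pi / 2 * ((ρ * Real.cosh d + Real.sinh d) / ((ρ + d) * ρ ^ 2)) := by
    unfold i0 k0 i1 k1
    rw [sd, cd, ← Real.cosh_sub_sinh ρ, ← Real.cosh_sub_sinh (ρ + d)]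
    generalize ρ + d = R at *
    field_simp; ring
  have hB' : i0 ρ * k1 (ρ + d) + i1 (ρ + d) * k0 ρ
      = Real.pi / 2 * (((ρ + d) * Real.cosh d - Real.sinh d) / ((ρ + d) ^ 2 * ρ)) := by
    unfold i0 k0 i1 k1
    rw [sd, cd, ← Real.cosh_sub_sinh ρ, ← Real.cosh_sub_sinh (ρ + d)]
    generalize ρ + d = R at *
    field_simp; ring
  have hE : i1 (ρ + d) * k1 ρ - i1 ρ * k1 (ρ + d)
      = Real.pi / 2 * ((((ρ + d) * ρ - 1) * Real.sinh d + d * Real.cosh d)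
        / ((ρ + d) ^ 2 * ρ ^ 2)) := by
    unfold i1 k1
    rw [sd, cd, ← Real.cosh_sub_sinh ρ, ← Real.cosh_sub_sinh (ρ + d)]
    obtain ⟨R, hRR⟩ : ∃ R, R = ρ + d := ⟨_, rfl⟩
    obtain rfl : d = R - ρ := by linarith
    rw [← hRR] at *
    field_simp; ring
  rw [hA, hB, hB', hE]
  generalize Real.sinh d = S at *
  generalize Real.cosh d = C at *
  generalize hF : ((ρ + d) * ρ - 1) * S + d * C = F at *
  generalize ρ + d = R at *
  generalize hDD : R ^ 3 - ρ ^ 3 = D at *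
  have hpi := Real.pi_pos
  have : Real.pi / 2 * (S / (R * ρ)) * (Real.pi / 2 * ((ρ * C + S) / (R * ρ ^ 2))
        - 3 * R ^ 2 / D * (Real.pi / 2 * (F / (R ^ 2 * ρ ^ 2))))
      - Real.pi / 2 * (F / (R ^ 2 * ρ ^ 2)) * (Real.pi / 2 * ((R * C - S) / (R ^ 2 * ρ))
        - 3 * ρ ^ 2 / D * (Real.pi / 2 * (F / (R ^ 2 * ρ ^ 2))))
      = (Real.pi / 2) ^ 2 / (D * R ^ 4 * ρ ^ 3) *
        (D * (R ^ 2 * S * (ρ * C + S) - F * (R * C - S)) - 3 * F * (R ^ 3 * S - ρ * F)) := by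
    field_simp
    ring
  rw [this]
  exact mul_neg_of_pos_of_neg (by positivity) hm
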